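/- Let τ > √6, let 0 < β < 1/6, and let ρ_min be a minimizing measure with support M. Let γ : (−δ, δ) → S² be a smooth curve parametrized by arc length with γ(0) = p = (1,0,0) and γ'(0) = (0,1,0), and assume that p is a uniform two-sided accumulation point on γ of scaling β. Set q₁ = (cos θ_max, 0, sin θ_max). Then there exist no δ' > 0 and no smooth curve c : (−δ', δ') → S² parametrized by arc length with c(0) = q₁ which osculates K(p) at q₁ and such that q₁ is an accumulation point of M ∩ c((−δ', δ')). -/

import Mathlib

open MeasureTheory Set
open scoped RealInnerProductSpace ENNReal

noncomputable section

/-- Euclidean three-space. -/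
abbrev E3 := EuclideanSpace ℝ (Fin 3)

/-- The unit sphere `S² ⊂ ℝ³`. -/
def Sphere2 : Set E3 := Metric.sphere 0 1

/-- The function `D(x,y) = (1/4)(1+⟨x,y⟩)(2 − τ²(1−⟨x,y⟩))`. -/
def Dfun (τ : ℝ) (x y : E3) : ℝ :=
  (1 / 4) * (1 + ⟪x, y⟫) * (2 - τ ^ 2 * (1 - ⟪x, y⟫))

/-- The Lagrangian `L = max(0, D)`. -/
def Lfun (τ : ℝ) (x y : E3) : ℝ := max 0 (Dfun τ x y)

/-- The causal action of a measure. -/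
def causalAction (τ : ℝ) (ρ : Measure E3) : ℝ :=
  ∫ x, ∫ y, Lfun τ x y ∂ρ ∂ρ

/-- `ρ` is a minimizing measure: a regular Borel probability measure supported on `S²`
minimizing the causal action among all such measures. -/
def IsMinimizer (τ : ℝ) (ρ : Measure E3) : Prop :=
  IsProbabilityMeasure ρ ∧ ρ.Regular ∧ ρ Sphere2ᶜ = 0 ∧
    ∀ ρ' : Measure E3, IsProbabilityMeasure ρ' → ρ'.Regular → ρ' Sphere2ᶜ = 0 →
      causalAction τ ρ ≤ causalAction τ ρ'

/-- The support of a measure. -/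
def msupport (ρ : Measure E3) : Set E3 :=
  {x | ∀ U : Set E3, IsOpen U → x ∈ U → 0 < ρ U}

/-- The opening angle `θ_max = arccos(1 − 2/τ²)`. -/
def θmax (τ : ℝ) : ℝ := Real.arccos (1 - 2 / τ ^ 2)

/-- The open light cone `I(p)`. -/
def lightConeI (τ : ℝ) (p : E3) : Set E3 := {q ∈ Sphere2 | 0 < Dfun τ p q}

/-- The boundary of the light cone `K(p)`. -/
def lightConeK (τ : ℝ) (p : E3) : Set E3 :=
  {q ∈ Sphere2 | ⟪p, q⟫ = Real.cos (θmax τ)}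

/-- Make a point of `ℝ³` from coordinates. -/
def mkE3 (a b c : ℝ) : E3 := (WithLp.equiv 2 (Fin 3 → ℝ)).symm ![a, b, c]

/-- A totally timelike set. -/
def TotallyTimelike (τ : ℝ) (Ω : Set E3) : Prop := ∀ x ∈ Ω, ∀ y ∈ Ω, 0 < Dfun τ x y

/-- `p` is an accumulation point of `A`: every neighborhood of `p` contains a point
of `A` different from `p`. -/
def AccumulationPt (p : E3) (A : Set E3) : Prop :=
  ∀ U ∈ nhds p, ∃ x ∈ A, x ∈ U ∧ x ≠ p

/-- `γ(0)` is a uniform two-sided accumulation point (of points of `M`) on `γ` of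
scaling `β`, where `γ` is defined on `(−δ, δ)`. -/
def UniformTwoSidedAcc (M : Set E3) (β δ : ℝ) (γ : ℝ → E3) : Prop :=
  ∃ ε₀ : ℝ, 0 < ε₀ ∧ ε₀ < δ ∧ ∀ ε : ℝ, 0 < ε → ε ≤ ε₀ →
    (∃ t ∈ Set.Ioo (-ε) (-(ε ^ (1 + β))), γ t ∈ M) ∧
    (∃ t ∈ Set.Ioo (ε ^ (1 + β)) ε, γ t ∈ M)

/-- The point `q₁ = (cos θ_max, 0, sin θ_max)`. -/
def q1pt (τ : ℝ) : E3 := mkE3 (Real.cos (θmax τ)) 0 (Real.sin (θmax τ))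

/-- The point `q₂ = (cos θ_max, 0, −sin θ_max)`. -/
def q2pt (τ : ℝ) : E3 := mkE3 (Real.cos (θmax τ)) 0 (-Real.sin (θmax τ))

/-- The curve `p_s = (cos s, sin s, 0)` along the equator. -/
def pcurve (s : ℝ) : E3 := mkE3 (Real.cos s) (Real.sin s) 0

/-- Geodesic ball in `S²` of radius `r` around `q`. -/
def geoBall (q : E3) (r : ℝ) : Set E3 := {x ∈ Sphere2 | Real.arccos ⟪q, x⟫ < r}

/-- The set `U_r = (B_r(q₁) ∪ B_r(q₂)) ∖ {q₁, q₂}`. -/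
def Uset (τ r : ℝ) : Set E3 := (geoBall (q1pt τ) r ∪ geoBall (q2pt τ) r) \ {q1pt τ, q2pt τ}

/-- The set `I_r(q) = I(q) ∖ U_r`. -/
def Iset (τ r : ℝ) (q : E3) : Set E3 := lightConeI τ q \ Uset τ r

/-- The point of `S²` with latitude `θ` (measured from the equator) and longitude `φ`. -/
def sphPt (θ φ : ℝ) : E3 :=
  mkE3 (Real.cos θ * Real.cos φ) (Real.cos θ * Real.sin φ) (Real.sin θ)

/-- The restrictions to `Ω` of polynomials of degree at most two on `ℝ³`. -/
def polyRestrictSet (Ω : Set E3) : Set (Ω → ℝ) :=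
  {f | ∃ P : MvPolynomial (Fin 3) ℝ, P.totalDegree ≤ 2 ∧
        ∀ x : Ω, f x = MvPolynomial.eval (fun i => (x : E3) i) P}

/-- The space `K(Ω)` of restrictions to `Ω` of polynomials of degree at most two. -/
def KSpace (Ω : Set E3) : Submodule ℝ (Ω → ℝ) := Submodule.span ℝ (polyRestrictSet Ω)

/-- Two-dimensional Hausdorff (surface) measure on `S²` restricted to `Ω`, as a
measure on `Ω`. -/
def surfΩ (Ω : Set E3) : Measure Ω := Measure.comap Subtype.val (μH[2] : Measure E3)

/-- The bilinear form `B(f,g) = ∫_Ω ∫_Ω D(x,y) f(x) g(y) dμ(x) dμ(y)` on functions on `Ω`. -/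
def Bform (τ : ℝ) (Ω : Set E3) (f g : Ω → ℝ) : ℝ :=
  ∫ x, ∫ y, Dfun τ (x : E3) (y : E3) * f x * g y ∂(surfΩ Ω) ∂(surfΩ Ω)

end

lemma inner3 (x y : E3) : ⟪x, y⟫ = x 0 * y 0 + x 1 * y 1 + x 2 * y 2 := by
  simp [PiLp.inner_apply, Fin.sum_univ_three]; ring

@[simp] lemma mkE3_0 (a b c : ℝ) : mkE3 a b c 0 = a := rfl
@[simp] lemma mkE3_1 (a b c : ℝ) : mkE3 a b c 1 = b := rfl
@[simp] lemma mkE3_2 (a b c : ℝ) : mkE3 a b c 2 = c := rfl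

lemma sph_norm {x : E3} (hx : x ∈ Sphere2) : ‖x‖ = 1 := by
  simpa [Sphere2] using hx

lemma sph_iff (x : E3) : x ∈ Sphere2 ↔ x 0 ^ 2 + x 1 ^ 2 + x 2 ^ 2 = 1 := by
  have h : ‖x‖ ^ 2 = x 0 ^ 2 + x 1 ^ 2 + x 2 ^ 2 := by
    rw [← real_inner_self_eq_norm_sq, inner3]; ring
  simp only [Sphere2, mem_sphere_iff_norm, sub_zero]
  rw [← h]
  constructor
  · intro h; rw [h]; norm_num
  · intro h
    have := norm_nonneg x
    nlinarith

lemma inner_abs_le {x y : E3} (hx : x ∈ Sphere2) (hy : y ∈ Sphere2) : |⟪x, y⟫| ≤ 1 := by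
  have := abs_real_inner_le_norm x y
  rwa [sph_norm hx, sph_norm hy, one_mul] at this

lemma L_nonneg (τ : ℝ) (x y : E3) : 0 ≤ Lfun τ x y := le_max_left _ _

lemma L_symm (τ : ℝ) (x y : E3) : Lfun τ x y = Lfun τ y x := by
  unfold Lfun Dfun; rw [real_inner_comm]

lemma L_cont (τ : ℝ) : Continuous (fun z : E3 × E3 => Lfun τ z.1 z.2) := by
  unfold Lfun Dfun; fun_prop

lemma L_cont_right (τ : ℝ) (x : E3) : Continuous (fun y : E3 => Lfun τ x y) := by
  unfold Lfun Dfun; fun_prop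

lemma L_bound (τ : ℝ) {x y : E3} (hx : x ∈ Sphere2) (hy : y ∈ Sphere2) :
    |Lfun τ x y| ≤ 1 + τ ^ 2 := by
  rw [abs_of_nonneg (L_nonneg _ _ _)]
  have h := abs_le.1 (inner_abs_le hx hy)
  unfold Lfun Dfun
  apply max_le
  · positivity
  · nlinarith [sq_nonneg τ, mul_nonneg (sq_nonneg τ) (by linarith : 0 ≤ 1 - ⟪x,y⟫), mul_nonneg (by linarith : 0 ≤ 1 + ⟪x,y⟫) (mul_nonneg (sq_nonneg τ) (by linarith : 0 ≤ 1 - ⟪x,y⟫))]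

lemma L_lip (τ : ℝ) {x x' y : E3} (hx : x ∈ Sphere2) (hx' : x' ∈ Sphere2) (hy : y ∈ Sphere2) :
    |Lfun τ x y - Lfun τ x' y| ≤ (1 + τ ^ 2) * ‖x - x'‖ := by
  have h := abs_le.1 (inner_abs_le hx hy)
  have h' := abs_le.1 (inner_abs_le hx' hy)
  have h1 : |Lfun τ x y - Lfun τ x' y| ≤ |Dfun τ x y - Dfun τ x' y| := by
    have := abs_max_sub_max_le_max 0 (Dfun τ x y) 0 (Dfun τ x' y)
    simpa [Lfun] using this
  refine h1.trans ?_
  have h2 : |⟪x, y⟫ - ⟪x', y⟫| ≤ ‖x - x'‖ := by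
    rw [← inner_sub_left]
    have := abs_real_inner_le_norm (x - x') y
    rwa [sph_norm hy, mul_one] at this
  have h3 : Dfun τ x y - Dfun τ x' y
      = (1 / 4) * (2 + τ ^ 2 * (⟪x, y⟫ + ⟪x', y⟫)) * (⟪x, y⟫ - ⟪x', y⟫) := by
    unfold Dfun; ring
  rw [h3, abs_mul]
  refine mul_le_mul ?_ h2 (abs_nonneg _) (by positivity)
  rw [abs_le]
  constructor <;> nlinarith [sq_nonneg τ, mul_nonneg (sq_nonneg τ) (by linarith : 0 ≤ 2 - (⟪x, y⟫ + ⟪x', y⟫)),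
    mul_nonneg (sq_nonneg τ) (by linarith : 0 ≤ 2 + (⟪x, y⟫ + ⟪x', y⟫))]

lemma msupport_eq (ρ : Measure E3) : msupport ρ = ρ.support := by
  rw [Measure.support_eq_forall_isOpen]
  ext x
  simp only [msupport, mem_ofPred_eq]
  constructor
  · intro h U hx hU; exact h U hU hx
  · intro h U hU hx; exact h U hx hU

lemma ae_sphere {ρ : Measure E3} (h : ρ Sphere2ᶜ = 0) : ∀ᵐ x ∂ρ, x ∈ Sphere2 := by
  rw [ae_iff]; exact h

lemma ae_msupport (ρ : Measure E3) : ∀ᵐ x ∂ρ, x ∈ msupport ρ := by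
  rw [msupport_eq]; exact Measure.support_mem_ae

lemma isClosed_msupport (ρ : Measure E3) : IsClosed (msupport ρ) := by
  rw [msupport_eq]; exact Measure.isClosed_support

lemma isClosed_Sphere2 : IsClosed Sphere2 := Metric.isClosed_sphere

lemma msupport_sub {ρ : Measure E3} (h : ρ Sphere2ᶜ = 0) : msupport ρ ⊆ Sphere2 := by
  rw [msupport_eq]; exact Measure.support_subset_of_isClosed isClosed_Sphere2 (ae_sphere h)

/-- integrability on the product -/
lemma integrable_prod {τ : ℝ} {ρ : Measure E3} [IsProbabilityMeasure ρ] (h : ρ Sphere2ᶜ = 0)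
    {φ : E3 × E3 → ℝ} (hφ : Measurable φ) (C : ℝ) (hC : ∀ z, |φ z| ≤ C) :
    Integrable (fun z : E3 × E3 => φ z * Lfun τ z.1 z.2) (ρ.prod ρ) := by
  refine Integrable.of_bound (C := C * (1 + τ ^ 2)) ?_ ?_
  · exact (hφ.mul (L_cont τ).measurable).aestronglyMeasurable
  · have h1 : ∀ᵐ z ∂(ρ.prod ρ), z.1 ∈ Sphere2 := Measure.quasiMeasurePreserving_fst.ae (ae_sphere h)
    have h2 : ∀ᵐ z ∂(ρ.prod ρ), z.2 ∈ Sphere2 := Measure.quasiMeasurePreserving_snd.ae (ae_sphere h)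
    filter_upwards [h1, h2] with z hz1 hz2
    rw [norm_mul, Real.norm_eq_abs, Real.norm_eq_abs]
    exact mul_le_mul (hC z) (L_bound τ hz1 hz2) (abs_nonneg _) ((abs_nonneg _).trans (hC z))

lemma integrable_L {τ : ℝ} {ρ : Measure E3} [IsProbabilityMeasure ρ] (h : ρ Sphere2ᶜ = 0)
    {x : E3} (hx : x ∈ Sphere2) : Integrable (fun y => Lfun τ x y) ρ := by
  refine Integrable.of_bound (C := 1 + τ ^ 2) (L_cont_right τ x).aestronglyMeasurable ?_
  filter_upwards [ae_sphere h] with y hy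
  exact L_bound τ hx hy

/-- variation by a density -/
lemma density_var {τ : ℝ} {ρ : Measure E3} (hmin : IsMinimizer τ ρ)
    {g : E3 → ℝ} (hg : Measurable g) (C : ℝ) (hC : ∀ x, |g x| ≤ C) (h0 : ∀ x, 0 ≤ g x)
    (h1 : ∫ x, g x ∂ρ = 1) :
    causalAction τ ρ ≤ ∫ z, g z.1 * g z.2 * Lfun τ z.1 z.2 ∂(ρ.prod ρ) := by
  obtain ⟨hP, hR, hS, hM⟩ := hmin
  have hgm : Measurable (fun x => ENNReal.ofReal (g x)) := hg.ennreal_ofReal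
  have hgi : Integrable g ρ := Integrable.of_bound (C := C) hg.aestronglyMeasurable (by
    filter_upwards with x; exact hC x)
  have hw : ∀ f : E3 → ℝ, ∫ x, f x ∂(ρ.withDensity fun x => ENNReal.ofReal (g x))
      = ∫ x, g x * f x ∂ρ := by
    intro f
    rw [integral_withDensity_eq_integral_toReal_smul hgm (by simp)]
    congr 1; ext x; simp [ENNReal.toReal_ofReal (h0 x)]
  have hP' : IsProbabilityMeasure (ρ.withDensity fun x => ENNReal.ofReal (g x)) := by
    refine ⟨?_⟩
    rw [withDensity_apply _ MeasurableSet.univ, Measure.restrict_univ,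
      ← ofReal_integral_eq_lintegral_ofReal hgi (by filter_upwards with x using h0 x), h1]
    simp
  have := hM (ρ.withDensity fun x => ENNReal.ofReal (g x)) hP' inferInstance
    (withDensity_absolutelyContinuous _ _ hS)
  refine this.trans (le_of_eq ?_)
  unfold causalAction
  rw [hw]
  have hint := integrable_prod (τ := τ) hS (φ := fun z => g z.1 * g z.2)
    ((hg.comp measurable_fst).mul (hg.comp measurable_snd)) (C * C) (by
      intro z; rw [abs_mul]; exact mul_le_mul (hC _) (hC _) (abs_nonneg _) ((abs_nonneg _).trans (hC z.1)))
  rw [integral_prod _ hint]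
  congr 1; ext x
  rw [hw, ← integral_const_mul]
  congr 1; ext y; ring

lemma quad_aux {A Q e : ℝ} (he : 0 < e) (h : ∀ ε : ℝ, |ε| ≤ e → 0 ≤ ε * A + ε ^ 2 * Q) :
    A = 0 ∧ 0 ≤ Q := by
  have hA : A = 0 := by
    by_contra hA
    have hpos : 0 < |A| := abs_pos.2 hA
    have hq : 0 < |Q| + 1 := by positivity
    set s := min e (|A| / (2 * (|Q| + 1))) with hs
    have hs0 : 0 < s := lt_min he (by positivity)
    have hs1 : s * (2 * (|Q| + 1)) ≤ |A| := by
      rw [← le_div_iff₀ (by positivity)]; exact min_le_right _ _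
    have hse : |s| ≤ e := by rw [abs_of_pos hs0]; exact min_le_left _ _
    have h1 := h s hse
    have h2 := h (-s) (by rwa [abs_neg])
    have h3 : s * |A| ≤ s * (s * Q) := by
      rcases abs_cases A with ⟨h, _⟩ | ⟨h, _⟩ <;> rw [h] <;> nlinarith
    have h4 : |A| ≤ s * Q := le_of_mul_le_mul_left h3 hs0
    have h5 : s * Q ≤ s * |Q| := mul_le_mul_of_nonneg_left (le_abs_self _) hs0.le
    nlinarith [abs_nonneg Q]
  refine ⟨hA, ?_⟩
  have := h e (by rw [abs_of_pos he])
  rw [hA] at this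
  have h2 : 0 < e ^ 2 := by positivity
  nlinarith

lemma psd_fun {τ : ℝ} {ρ : Measure E3} (hmin : IsMinimizer τ ρ)
    {ψ : E3 → ℝ} (hψ : Measurable ψ) (C : ℝ) (hC : ∀ x, |ψ x| ≤ C) :
    0 ≤ ∫ z, ψ z.1 * ψ z.2 * Lfun τ z.1 z.2 ∂(ρ.prod ρ) := by
  have hmin' := hmin
  obtain ⟨hP, hR, hS, hM⟩ := hmin
  have hC0 : 0 ≤ C := (abs_nonneg _).trans (hC 0)
  obtain ⟨m, hm⟩ : ∃ m, m = ∫ x, ψ x ∂ρ := ⟨_, rfl⟩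
  have hψi : Integrable ψ ρ := Integrable.of_bound (C := C) hψ.aestronglyMeasurable (by
    filter_upwards with x; exact hC x)
  have i0 := integrable_prod (τ := τ) hS (φ := fun z => 1) measurable_const 1 (by simp)
  have i1 := integrable_prod (τ := τ) hS (φ := fun z => ψ z.1) (hψ.comp measurable_fst) C
    (fun z => hC _)
  have i2 := integrable_prod (τ := τ) hS (φ := fun z => ψ z.2) (hψ.comp measurable_snd) C
    (fun z => hC _)
  have i3 := integrable_prod (τ := τ) hS (φ := fun z => ψ z.1 * ψ z.2)
    ((hψ.comp measurable_fst).mul (hψ.comp measurable_snd)) (C * C) (by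
      intro z; rw [abs_mul]; exact mul_le_mul (hC _) (hC _) (abs_nonneg _) hC0)
  have hSe : causalAction τ ρ = ∫ z, 1 * Lfun τ z.1 z.2 ∂(ρ.prod ρ) := by
    rw [integral_prod _ i0]; simp [causalAction]
  set S := ∫ z, 1 * Lfun τ z.1 z.2 ∂(ρ.prod ρ) with hSd
  set A1 := ∫ z, ψ z.1 * Lfun τ z.1 z.2 ∂(ρ.prod ρ) with hA1
  set A2 := ∫ z, ψ z.2 * Lfun τ z.1 z.2 ∂(ρ.prod ρ) with hA2
  set R := ∫ z, ψ z.1 * ψ z.2 * Lfun τ z.1 z.2 ∂(ρ.prod ρ) with hRd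
  have hS0 : 0 ≤ S := integral_nonneg (fun z => by simpa using L_nonneg τ z.1 z.2)
  have key : ∀ ε : ℝ, |ε| ≤ 1 / (C + |m| + 1) →
      0 ≤ ε * ((A1 + A2) - 2 * m * S) + ε ^ 2 * (m ^ 2 * S - m * (A1 + A2) + R) := by
    intro ε hε
    have hb : ∀ x, |ε * (ψ x - m)| ≤ 1 := by
      intro x
      rw [abs_mul]
      have h1 : |ψ x - m| ≤ C + |m| + 1 := by
        have := abs_sub (ψ x) m
        have := hC x
        linarith
      calc |ε| * |ψ x - m| ≤ 1 / (C + |m| + 1) * (C + |m| + 1) :=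
            mul_le_mul hε h1 (abs_nonneg _) (by positivity)
        _ = 1 := by field_simp
    have := density_var hmin' (g := fun x => 1 + ε * (ψ x - m))
      (measurable_const.add (measurable_const.mul (hψ.sub measurable_const))) 2 (by
        intro x
        have := abs_le.1 (hb x)
        rw [abs_le]; constructor <;> linarith) (by
        intro x
        have := abs_le.1 (hb x)
        linarith) (by
        have j1 : Integrable (fun x => ψ x - m) ρ := hψi.sub (integrable_const _)
        have j2 : Integrable (fun x => ε * (ψ x - m)) ρ := j1.const_mul _
        rw [integral_add (integrable_const _) j2,
          integral_const_mul, integral_sub hψi (integrable_const _)]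
        simp [← hm])
    rw [hSe] at this
    have he : ∫ z, (1 + ε * (ψ z.1 - m)) * (1 + ε * (ψ z.2 - m)) * Lfun τ z.1 z.2 ∂(ρ.prod ρ)
        = (1 - ε * m) ^ 2 * S + (1 - ε * m) * ε * A1 + (1 - ε * m) * ε * A2 + ε ^ 2 * R := by
      rw [hSd, hA1, hA2, hRd, ← integral_const_mul, ← integral_const_mul, ← integral_const_mul,
        ← integral_const_mul, ← integral_add, ← integral_add, ← integral_add]
      · congr 1; ext z; ring
      · exact ((i0.const_mul _).add (i1.const_mul _)).add (i2.const_mul _)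
      · exact i3.const_mul _
      · exact (i0.const_mul _).add (i1.const_mul _)
      · exact i2.const_mul _
      · exact i0.const_mul _
      · exact i1.const_mul _
    rw [he] at this
    nlinarith
  obtain ⟨ha, hq⟩ := quad_aux (by positivity) key
  have : A1 + A2 = 2 * m * S := by linarith
  rw [this] at hq
  nlinarith [mul_nonneg (sq_nonneg m) hS0]

lemma psd_pts {τ : ℝ} {ρ : Measure E3} (hmin : IsMinimizer τ ρ) {ι : Type} [Fintype ι]
    (x : ι → E3) (hx : ∀ i, x i ∈ msupport ρ) (w : ι → ℝ) :
    0 ≤ ∑ i, ∑ j, w i * w j * Lfun τ (x i) (x j) := by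
  have hmin' := hmin
  obtain ⟨hP, hR, hS, hM⟩ := hmin
  set W := ∑ i, ∑ j, |w i * w j| * (2 * (1 + τ ^ 2)) with hW
  have hW0 : 0 ≤ W := Finset.sum_nonneg fun i _ => Finset.sum_nonneg fun j _ => by positivity
  have key : ∀ r > 0, 0 ≤ ∑ i, ∑ j, w i * w j * Lfun τ (x i) (x j) + W * r := by
    intro r hr
    set B : ι → Set E3 := fun i => Metric.ball (x i) r with hB
    have hBm : ∀ i, MeasurableSet (B i) := fun i => Metric.isOpen_ball.measurableSet
    have hBp : ∀ i, 0 < ρ.real (B i) := by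
      intro i
      have := hx i (B i) Metric.isOpen_ball (Metric.mem_ball_self hr)
      exact ENNReal.toReal_pos this.ne' (measure_ne_top _ _)
    set u : ι → E3 → ℝ := fun i => (B i).indicator (fun _ => (ρ.real (B i))⁻¹) with hu
    have hum : ∀ i, Measurable (u i) := fun i => measurable_const.indicator (hBm i)
    have hu0 : ∀ i y, 0 ≤ u i y := fun i y =>
      Set.indicator_nonneg (fun _ _ => inv_nonneg.2 (hBp i).le) y
    have hub : ∀ i y, |u i y| ≤ (ρ.real (B i))⁻¹ := by
      intro i y
      rw [abs_of_nonneg (hu0 i y)]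
      exact Set.indicator_le_self' (fun _ _ => inv_nonneg.2 (hBp i).le) y
    have hui : ∀ i, ∫ y, u i y ∂ρ = 1 := by
      intro i
      rw [hu]; simp only
      rw [integral_indicator_const _ (hBm i)]
      simp [(hBp i).ne']
    have huint : ∀ i, Integrable (u i) ρ := fun i =>
      Integrable.of_bound (hum i).aestronglyMeasurable _ (by filter_upwards with y using hub i y)
    have iu : ∀ i j, Integrable (fun z : E3 × E3 => u i z.1 * u j z.2) (ρ.prod ρ) := fun i j =>
      (huint i).mul_prod (huint j)
    have iL : ∀ i j, Integrable (fun z : E3 × E3 => u i z.1 * u j z.2 * Lfun τ z.1 z.2)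
        (ρ.prod ρ) := fun i j =>
      integrable_prod (τ := τ) hS (φ := fun z => u i z.1 * u j z.2)
        (((hum i).comp measurable_fst).mul ((hum j).comp measurable_snd))
        ((ρ.real (B i))⁻¹ * (ρ.real (B j))⁻¹) (by
          intro z; rw [abs_mul]
          exact mul_le_mul (hub _ _) (hub _ _) (abs_nonneg _) (inv_nonneg.2 (hBp i).le))
    have hiu : ∀ i j, ∫ z, u i z.1 * u j z.2 ∂(ρ.prod ρ) = 1 := by
      intro i j
      rw [integral_prod_mul (u i) (u j), hui, hui]; norm_num
    have h1 : ∀ᵐ z ∂(ρ.prod ρ), z.1 ∈ Sphere2 := Measure.quasiMeasurePreserving_fst.ae (ae_sphere hS)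
    have h2 : ∀ᵐ z ∂(ρ.prod ρ), z.2 ∈ Sphere2 := Measure.quasiMeasurePreserving_snd.ae (ae_sphere hS)
    have hxs : ∀ i, x i ∈ Sphere2 := fun i => msupport_sub hS (hx i)
    have hclose : ∀ i j, |∫ z, u i z.1 * u j z.2 * Lfun τ z.1 z.2 ∂(ρ.prod ρ) -
        Lfun τ (x i) (x j)| ≤ 2 * (1 + τ ^ 2) * r := by
      intro i j
      have e1 : ∫ z, u i z.1 * u j z.2 * Lfun τ z.1 z.2 ∂(ρ.prod ρ) - Lfun τ (x i) (x j)
          = ∫ z, u i z.1 * u j z.2 * (Lfun τ z.1 z.2 - Lfun τ (x i) (x j)) ∂(ρ.prod ρ) := by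
        simp_rw [mul_sub]
        rw [integral_sub (iL i j) ((iu i j).mul_const _), integral_mul_const, hiu, one_mul]
      rw [e1]
      have e2 : ∫ z, (u i z.1 * u j z.2) * (2 * (1 + τ ^ 2) * r) ∂(ρ.prod ρ)
          = 2 * (1 + τ ^ 2) * r := by
        rw [integral_mul_const, hiu, one_mul]
      rw [← e2, ← Real.norm_eq_abs]
      refine norm_integral_le_of_norm_le ((iu i j).mul_const _) ?_
      filter_upwards [h1, h2] with z hz1 hz2
      rw [norm_mul, Real.norm_eq_abs, Real.norm_eq_abs, abs_mul, abs_of_nonneg (hu0 i z.1),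
        abs_of_nonneg (hu0 j z.2)]
      by_cases hzi : z.1 ∈ B i
      · by_cases hzj : z.2 ∈ B j
        · refine mul_le_mul_of_nonneg_left ?_ (mul_nonneg (hu0 _ _) (hu0 _ _))
          have l1 := L_lip τ hz1 (hxs i) hz2
          have l2 := L_lip τ hz2 (hxs j) (hxs i)
          rw [L_symm τ z.2, L_symm τ (x j)] at l2
          have d1 : ‖z.1 - x i‖ ≤ r := by
            rw [← dist_eq_norm]; exact (Metric.mem_ball.1 hzi).le
          have d2 : ‖z.2 - x j‖ ≤ r := by
            rw [← dist_eq_norm]; exact (Metric.mem_ball.1 hzj).le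
          have t : Lfun τ z.1 z.2 - Lfun τ (x i) (x j) = (Lfun τ z.1 z.2 - Lfun τ (x i) z.2)
            + (Lfun τ (x i) z.2 - Lfun τ (x i) (x j)) := by ring
          rw [t]
          refine (abs_add_le _ _).trans ?_
          have k : 0 ≤ 1 + τ ^ 2 := by positivity
          have := mul_le_mul_of_nonneg_left d1 k
          have := mul_le_mul_of_nonneg_left d2 k
          linarith
        · have : u j z.2 = 0 := Set.indicator_of_notMem hzj _
          simp [this]
      · have : u i z.1 = 0 := Set.indicator_of_notMem hzi _
        simp [this]
    have hpsd := psd_fun hmin' (ψ := fun y => ∑ i, w i * u i y)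
      (Finset.measurable_fun_sum _ fun i _ => (hum i).const_mul _)
      (∑ i, |w i| * (ρ.real (B i))⁻¹) (by
        intro y
        refine (Finset.abs_sum_le_sum_abs _ _).trans (Finset.sum_le_sum fun i _ => ?_)
        rw [abs_mul]
        exact mul_le_mul_of_nonneg_left (hub i y) (abs_nonneg _))
    have e3 : ∫ z, (∑ i, w i * u i z.1) * (∑ i, w i * u i z.2) * Lfun τ z.1 z.2 ∂(ρ.prod ρ)
        = ∑ i, ∑ j, w i * w j * ∫ z, u i z.1 * u j z.2 * Lfun τ z.1 z.2 ∂(ρ.prod ρ) := by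
      simp_rw [← integral_const_mul]
      have ii : ∀ i j, Integrable (fun z : E3 × E3 => w i * w j * (u i z.1 * u j z.2 * Lfun τ z.1 z.2)) (ρ.prod ρ) := fun i j => (iL i j).const_mul _
      have : ∀ i, ∑ j, ∫ z, w i * w j * (u i z.1 * u j z.2 * Lfun τ z.1 z.2) ∂(ρ.prod ρ) = ∫ z, ∑ j, w i * w j * (u i z.1 * u j z.2 * Lfun τ z.1 z.2) ∂(ρ.prod ρ) := fun i => (integral_finsetSum _ fun j _ => ii i j).symm
      simp_rw [this]
      rw [← integral_finsetSum _ fun i _ => integrable_finsetSum _ fun j _ => ii i j]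
      congr 1; ext z
      rw [Finset.sum_mul_sum, Finset.sum_mul]
      refine Finset.sum_congr rfl fun i _ => ?_
      rw [Finset.sum_mul]
      exact Finset.sum_congr rfl fun j _ => by ring
    rw [e3] at hpsd
    refine hpsd.trans ?_
    rw [hW, Finset.sum_mul, ← Finset.sum_add_distrib]
    refine Finset.sum_le_sum fun i _ => ?_
    rw [Finset.sum_mul, ← Finset.sum_add_distrib]
    refine Finset.sum_le_sum fun j _ => ?_
    have := hclose i j
    set I := ∫ z, u i z.1 * u j z.2 * Lfun τ z.1 z.2 ∂(ρ.prod ρ)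
    have h3 : w i * w j * (I - Lfun τ (x i) (x j)) ≤ |w i * w j| * (2 * (1 + τ ^ 2) * r) := by
      refine (le_abs_self _).trans ?_
      rw [abs_mul]
      exact mul_le_mul_of_nonneg_left this (abs_nonneg _)
    linarith
  by_contra hneg
  push Not at hneg
  set Q := ∑ i, ∑ j, w i * w j * Lfun τ (x i) (x j)
  have := key (-Q / (2 * (W + 1))) (by apply div_pos <;> linarith)
  have h5 : W * (-Q / (2 * (W + 1))) ≤ -Q / 2 := by
    rw [mul_div_assoc', div_le_div_iff₀ (by positivity) (by norm_num)]
    nlinarith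
  linarith

lemma integrable_L' {τ : ℝ} {ρ : Measure E3} [IsProbabilityMeasure ρ] (h : ρ Sphere2ᶜ = 0)
    (x : E3) : Integrable (fun y => Lfun τ x y) ρ := by
  have hc : IsCompact Sphere2 := isCompact_sphere 0 1
  obtain ⟨C, hC⟩ := hc.exists_bound_of_continuousOn (L_cont_right τ x).continuousOn
  refine Integrable.of_bound (C := C) (L_cont_right τ x).aestronglyMeasurable ?_
  filter_upwards [ae_sphere h] with y hy
  exact hC y hy

lemma EL1 {τ : ℝ} {ρ : Measure E3} (hmin : IsMinimizer τ ρ) {x : E3} (hx : x ∈ Sphere2) :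
    causalAction τ ρ ≤ ∫ y, Lfun τ x y ∂ρ := by
  obtain ⟨hP, hR, hS, hM⟩ := hmin
  have i0 := integrable_prod (τ := τ) hS (φ := fun z => 1) measurable_const 1 (by simp)
  simp only [one_mul] at i0
  have il : Integrable (fun x => ∫ y, Lfun τ x y ∂ρ) ρ := i0.integral_prod_left
  set S := causalAction τ ρ with hSd
  set l := ∫ y, Lfun τ x y ∂ρ with hl
  have key : ∀ ε : ℝ, 0 < ε → ε ≤ 1 → S ≤ (1 - ε) * ((1 - ε) * S + ε * l) +
      ε * ((1 - ε) * l + ε * Lfun τ x x) := by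
    intro ε h0 h1
    set ρ' := ENNReal.ofReal (1 - ε) • ρ + ENNReal.ofReal ε • Measure.dirac x with hρ'
    have hint : ∀ f : E3 → ℝ, Integrable f ρ → ∫ y, f y ∂ρ' = (1 - ε) * ∫ y, f y ∂ρ + ε * f x := by
      intro f hf
      rw [hρ', integral_add_measure (hf.smul_measure ENNReal.ofReal_ne_top)
        ((integrable_dirac (by simp)).smul_measure ENNReal.ofReal_ne_top),
        integral_smul_measure, integral_smul_measure, integral_dirac,
        ENNReal.toReal_ofReal (by linarith), ENNReal.toReal_ofReal h0.le]
      simp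
    have hP' : IsProbabilityMeasure ρ' := by
      refine ⟨?_⟩
      rw [hρ']
      simp only [Measure.coe_add, Measure.coe_smul, Pi.add_apply, Pi.smul_apply, measure_univ,
        smul_eq_mul, mul_one]
      rw [← ENNReal.ofReal_add (by linarith) h0.le]
      simp
    have hS' : ρ' Sphere2ᶜ = 0 := by
      rw [hρ']
      simp [hS, hx]
    have := hM ρ' hP' inferInstance hS'
    refine this.trans (le_of_eq ?_)
    unfold causalAction
    have e1 : ∀ x', ∫ y, Lfun τ x' y ∂ρ' = (1 - ε) * ∫ y, Lfun τ x' y ∂ρ + ε * Lfun τ x x' := by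
      intro x'
      rw [hint _ (integrable_L' hS x'), L_symm τ x' x]
    simp_rw [e1]
    have j : Integrable (fun x' => (1 - ε) * ∫ y, Lfun τ x' y ∂ρ + ε * Lfun τ x x') ρ :=
      (il.const_mul _).add ((integrable_L' hS x).const_mul _)
    rw [hint _ j,
      integral_add (il.const_mul _) ((integrable_L' hS x).const_mul _), integral_const_mul,
      integral_const_mul]
    rfl
  by_contra hlt
  push Not at hlt
  have hLx : 0 ≤ Lfun τ x x := L_nonneg _ _ _
  have k1 : ∀ ε : ℝ, 0 < ε → ε ≤ 1 → 2 * (S - l) ≤ ε * (S - 2 * l + Lfun τ x x) := by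
    intro ε h0 h1
    have := key ε h0 h1
    have h2 : ε * (2 * (S - l)) ≤ ε * (ε * (S - 2 * l + Lfun τ x x)) := by nlinarith
    exact le_of_mul_le_mul_left h2 h0
  set V := S - 2 * l + Lfun τ x x
  have hV : 0 < |V| + 1 := by positivity
  set e := min 1 ((S - l) / (|V| + 1))
  have he : 0 < e := lt_min one_pos (div_pos (by linarith) hV)
  have h3 := k1 e he (min_le_left _ _)
  have h4 : e * (|V| + 1) ≤ S - l := by
    rw [← le_div_iff₀ hV]; exact min_le_right _ _
  have h5 : e * V ≤ e * |V| := mul_le_mul_of_nonneg_left (le_abs_self _) he.le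
  nlinarith

lemma EL2 {τ : ℝ} {ρ : Measure E3} (hmin : IsMinimizer τ ρ) {p : E3} (hp : p ∈ msupport ρ) :
    ∫ y, Lfun τ p y ∂ρ ≤ causalAction τ ρ := by
  have hmin' := hmin
  obtain ⟨hP, hR, hS, hM⟩ := hmin
  have i0 := integrable_prod (τ := τ) hS (φ := fun z => 1) measurable_const 1 (by simp)
  simp only [one_mul] at i0
  have il : Integrable (fun x => ∫ y, Lfun τ x y ∂ρ) ρ := i0.integral_prod_left
  have hae : ∀ᵐ x ∂ρ, ∫ y, Lfun τ x y ∂ρ - causalAction τ ρ = 0 := by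
    have h0 : 0 ≤ᵐ[ρ] fun x => ∫ y, Lfun τ x y ∂ρ - causalAction τ ρ := by
      filter_upwards [ae_sphere hS] with x hx
      have := EL1 hmin' hx
      simp only [Pi.zero_apply]
      linarith
    have h1 : ∫ x, (∫ y, Lfun τ x y ∂ρ - causalAction τ ρ) ∂ρ = 0 := by
      rw [integral_sub il (integrable_const _)]
      simp [causalAction]
    exact (integral_eq_zero_iff_of_nonneg_ae h0 (il.sub (integrable_const _))).1 h1
  have hps := msupport_sub hS hp
  refine le_of_forall_pos_le_add fun e he => ?_
  set r := e / (1 + τ ^ 2) with hr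
  have hr0 : 0 < r := by positivity
  have hpos := hp (Metric.ball p r) Metric.isOpen_ball (Metric.mem_ball_self hr0)
  obtain ⟨x, hxb, hxe, hxs⟩ : ∃ x, x ∈ Metric.ball p r ∧
      (∫ y, Lfun τ x y ∂ρ - causalAction τ ρ = 0) ∧ x ∈ Sphere2 := by
    by_contra hcon
    push Not at hcon
    have : ∀ᵐ x ∂ρ, x ∉ Metric.ball p r := by
      filter_upwards [hae, ae_sphere hS] with x h1 h2 h3
      exact hcon x h3 h1 h2
    rw [ae_iff] at this
    simp only [not_not] at this
    exact hpos.ne' this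
  have hle : ∫ y, Lfun τ p y ∂ρ ≤ ∫ y, (Lfun τ x y + e) ∂ρ := by
    refine integral_mono_ae (integrable_L' hS p) ((integrable_L' hS x).add (integrable_const _)) ?_
    filter_upwards [ae_sphere hS] with y hy
    have h1 := (abs_le.1 (L_lip τ hps hxs hy)).2
    have h2 : ‖p - x‖ ≤ r := by
      rw [← dist_eq_norm, dist_comm]; exact (Metric.mem_ball.1 hxb).le
    have h3 : (1 + τ ^ 2) * ‖p - x‖ ≤ e := by
      refine (mul_le_mul_of_nonneg_left h2 (by positivity)).trans (le_of_eq ?_)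
      rw [hr]; field_simp
    linarith
  rw [integral_add (integrable_L' hS x) (integrable_const _)] at hle
  simp at hle
  linarith

lemma D_eq (τ : ℝ) (x y : E3) :
    Dfun τ x y = (1 / 4) * ((2 - τ ^ 2) + 2 * ⟪x, y⟫ + τ ^ 2 * ⟪x, y⟫ ^ 2) := by
  unfold Dfun; ring

lemma coord_le {y : E3} (hy : y ∈ Sphere2) : |y 0| ≤ 1 ∧ |y 1| ≤ 1 := by
  rw [sph_iff] at hy
  constructor <;> rw [abs_le] <;> constructor <;>
    nlinarith [sq_nonneg (y 0), sq_nonneg (y 1), sq_nonneg (y 2)]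

lemma coord_norm_le (x : E3) (i : Fin 3) : |x i| ≤ ‖x‖ := by
  simpa using PiLp.norm_apply_le x i

noncomputable def Lam (τ : ℝ) (y : E3) : ℝ := (1 / 2) * ((τ ^ 2 / 2) * y 1 ^ 2 - (1 / 2) * (1 + τ ^ 2 * y 0) * y 0)

noncomputable def del (τ : ℝ) (y : E3) : ℝ := (1 / 2) * (1 + τ ^ 2 * y 0) * y 1

lemma trig_aux {s : ℝ} (hs : |s| ≤ 1) :
    |Real.cos s - (1 - s ^ 2 / 2)| ≤ |s| ^ 3 ∧ |Real.sin s - s| ≤ |s| ^ 3 := by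
  have h1 := Real.cos_bound hs
  have h2 := Real.sin_bound hs
  have h0 := abs_nonneg s
  have h4 : |s| ^ 4 ≤ |s| ^ 3 := pow_le_pow_of_le_one h0 hs (by norm_num)
  have h3 : 0 ≤ |s| ^ 3 := by positivity
  refine ⟨by nlinarith, ?_⟩
  have e : Real.sin s - s = (Real.sin s - (s - s ^ 3 / 6)) + (- s ^ 3 / 6) := by ring
  rw [e]
  refine (abs_add_le _ _).trans ?_
  have : |- s ^ 3 / 6| = |s| ^ 3 / 6 := by
    rw [abs_div, abs_neg, abs_pow]; norm_num
  rw [this]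
  nlinarith

lemma h_exp (τ : ℝ) {y : E3} (hy : y ∈ Sphere2) {s : ℝ} (hs : |s| ≤ 1) :
    |Dfun τ (pcurve s) y - Dfun τ (mkE3 1 0 0) y - del τ y * s - Lam τ y * s ^ 2|
      ≤ (1 + 5 * τ ^ 2) * |s| ^ 3 := by
  obtain ⟨h1, h2⟩ := trig_aux hs
  obtain ⟨b0, b1⟩ := coord_le hy
  have hz := abs_nonneg s
  obtain ⟨r1, hr1⟩ : ∃ r, r = Real.cos s - (1 - s ^ 2 / 2) := ⟨_, rfl⟩
  obtain ⟨r2, hr2⟩ : ∃ r, r = Real.sin s - s := ⟨_, rfl⟩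
  rw [← hr1] at h1
  rw [← hr2] at h2
  have hc : Real.cos s = 1 - s ^ 2 / 2 + r1 := by linarith
  have hsn : Real.sin s = s + r2 := by linarith
  obtain ⟨R, hR⟩ : ∃ R, R = r1 * y 0 + r2 * y 1 := ⟨_, rfl⟩
  have hRb : |R| ≤ 2 * |s| ^ 3 := by
    rw [hR]
    refine (abs_add_le _ _).trans ?_
    rw [abs_mul, abs_mul]
    nlinarith [abs_nonneg (y 0), abs_nonneg (y 1), abs_nonneg r1, abs_nonneg r2]
  obtain ⟨G, hG⟩ : ∃ G, G = - y 0 * s ^ 2 / 2 + R := ⟨_, rfl⟩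
  have h32 : |s| ^ 3 ≤ |s| ^ 2 := pow_le_pow_of_le_one hz hs (by norm_num)
  have h43 : |s| ^ 4 ≤ |s| ^ 3 := pow_le_pow_of_le_one hz hs (by norm_num)
  have hGb : |G| ≤ 3 * |s| ^ 2 := by
    rw [hG]
    refine (abs_add_le _ _).trans ?_
    have : |- y 0 * s ^ 2 / 2| = |y 0| * |s| ^ 2 / 2 := by
      rw [abs_div, abs_mul, abs_neg, abs_pow]; norm_num
    rw [this]
    nlinarith [abs_nonneg (y 0), sq_nonneg |s|]
  have e : Dfun τ (pcurve s) y - Dfun τ (mkE3 1 0 0) y - del τ y * s - Lam τ y * s ^ 2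
      = (1 / 2) * R + τ ^ 2 * ((1 / 2) * y 0 * R + (1 / 4) * (2 * y 1 * s * G + G ^ 2)) := by
    rw [D_eq, D_eq, inner3, inner3, hG, hR]
    simp only [pcurve, mkE3_0, mkE3_1, mkE3_2, hc, hsn, del, Lam]
    ring
  rw [e]
  have t1 : |(1 / 2) * R| ≤ |s| ^ 3 := by
    rw [abs_mul, abs_of_pos (by norm_num : (0:ℝ) < 1 / 2)]; linarith
  have t2 : |(1 / 2) * y 0 * R| ≤ |s| ^ 3 := by
    rw [abs_mul, abs_mul, abs_of_pos (by norm_num : (0:ℝ) < 1 / 2)]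
    nlinarith [abs_nonneg (y 0), abs_nonneg R]
  have t3 : |2 * y 1 * s * G| ≤ 6 * |s| ^ 3 := by
    rw [abs_mul, abs_mul, abs_mul, abs_of_pos (by norm_num : (0:ℝ) < 2)]
    have : |y 1| * (|s| * |G|) ≤ 1 * (|s| * (3 * |s| ^ 2)) := by
      apply mul_le_mul b1 _ (by positivity) (by norm_num)
      exact mul_le_mul_of_nonneg_left hGb hz
    nlinarith
  have t4 : |G ^ 2| ≤ 9 * |s| ^ 3 := by
    rw [abs_pow]
    have : |G| ^ 2 ≤ (3 * |s| ^ 2) ^ 2 := pow_le_pow_left₀ (abs_nonneg _) hGb 2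
    nlinarith
  have t5 : |(1 / 2) * y 0 * R + (1 / 4) * (2 * y 1 * s * G + G ^ 2)| ≤ 5 * |s| ^ 3 := by
    refine (abs_add_le _ _).trans ?_
    rw [abs_mul (1/4), abs_of_pos (by norm_num : (0:ℝ) < 1 / 4)]
    have := abs_add_le (2 * y 1 * s * G) (G ^ 2)
    nlinarith
  refine (abs_add_le _ _).trans ?_
  rw [abs_mul (τ ^ 2), abs_of_nonneg (sq_nonneg τ)]
  nlinarith [mul_le_mul_of_nonneg_left t5 (sq_nonneg τ)]

lemma pcurve_mem (s : ℝ) : pcurve s ∈ Sphere2 := by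
  rw [sph_iff]; simp [pcurve]

lemma norm_le3 (x : E3) : ‖x‖ ≤ |x 0| + |x 1| + |x 2| := by
  have h : ‖x‖ ^ 2 = x 0 ^ 2 + x 1 ^ 2 + x 2 ^ 2 := by
    rw [← real_inner_self_eq_norm_sq, inner3]; ring
  refine abs_le_of_sq_le_sq' ?_ (by positivity) |>.2
  rw [h]
  nlinarith [sq_abs (x 0), sq_abs (x 1), sq_abs (x 2), abs_nonneg (x 0), abs_nonneg (x 1),
    abs_nonneg (x 2), mul_nonneg (abs_nonneg (x 0)) (abs_nonneg (x 1)),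
    mul_nonneg (abs_nonneg (x 0)) (abs_nonneg (x 2)), mul_nonneg (abs_nonneg (x 1)) (abs_nonneg (x 2))]

lemma pcurve_close {s : ℝ} (hs : |s| ≤ 1) : ‖pcurve s - mkE3 1 s 0‖ ≤ 3 * s ^ 2 := by
  obtain ⟨h1, h2⟩ := trig_aux hs
  have hz := abs_nonneg s
  have h32 : |s| ^ 3 ≤ |s| ^ 2 := pow_le_pow_of_le_one hz hs (by norm_num)
  rw [sq_abs] at h32
  refine (norm_le3 _).trans ?_
  simp only [PiLp.sub_apply, pcurve, mkE3_0, mkE3_1, mkE3_2, sub_self, abs_zero, add_zero]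
  have : |Real.cos s - 1| ≤ |Real.cos s - (1 - s ^ 2 / 2)| + |- s ^ 2 / 2| := by
    refine le_trans (le_of_eq ?_) (abs_add_le _ _)
    congr 1; ring
  have h3 : |- s ^ 2 / 2| = s ^ 2 / 2 := by
    rw [abs_div, abs_neg, abs_of_nonneg (sq_nonneg s)]; norm_num
  nlinarith [sq_nonneg s]

lemma frac_aux {α β u t K : ℝ} (hu : 0 < u) (ht : 0 < t) (h1 : |α| ≤ K * u ^ 2)
    (h2 : |β| ≤ K * t ^ 2) : |α / u + β / t| ≤ K * (u + t) := by
  refine (abs_add_le _ _).trans ?_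
  rw [abs_div, abs_div, abs_of_pos hu, abs_of_pos ht, mul_add]
  apply add_le_add
  · rw [div_le_iff₀ hu]; nlinarith
  · rw [div_le_iff₀ ht]; nlinarith

lemma prod_aux {A B a b C e : ℝ} (hC : 0 ≤ C) (ha : |a| ≤ 1) (hb : |b| ≤ 1) (he : 0 ≤ e) (he1 : e ≤ 1)
    (hA : |A - a| ≤ C * e) (hB : |B - b| ≤ C * e) : |A * B - a * b| ≤ (2 * C + C ^ 2) * e := by
  have e1 : A * B - a * b = a * (B - b) + ((A - a) * b + (A - a) * (B - b)) := by ring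
  rw [e1]
  refine (abs_add_le _ _).trans ?_
  refine (add_le_add_right (abs_add_le _ _) _).trans ?_
  rw [abs_mul, abs_mul, abs_mul]
  have t1 : |a| * |B - b| ≤ 1 * (C * e) := mul_le_mul ha hB (abs_nonneg _) (by norm_num)
  have t2 : |A - a| * |b| ≤ (C * e) * 1 := mul_le_mul hA hb (abs_nonneg _) (by positivity)
  have t3 : |A - a| * |B - b| ≤ (C * e) * (C * e) := mul_le_mul hA hB (abs_nonneg _) (by positivity)
  have t4 : (C * e) * (C * e) ≤ C ^ 2 * e := by
    have : C ^ 2 * (e * e) ≤ C ^ 2 * (1 * e) := by gcongr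
    nlinarith
  nlinarith

lemma N_bound (τ C u t : ℝ) (hC : 0 ≤ C) (hu : 0 < u) (hu1 : u ≤ 1) (ht : 0 < t) (ht1 : t ≤ 1)
    (X Y : E3) (hX : ‖X - mkE3 1 (-u) 0‖ ≤ C * u ^ 2) (hY : ‖Y - mkE3 1 t 0‖ ≤ C * t ^ 2) :
    (1 / u) ^ 2 * Dfun τ X X + (1 / t) ^ 2 * Dfun τ Y Y
      + (1 / u + 1 / t) ^ 2 * Dfun τ (mkE3 1 0 0) (mkE3 1 0 0) + 2 * (1 / u) * (1 / t) * Dfun τ X Y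
      - 2 * (1 / u) * (1 / u + 1 / t) * Dfun τ X (mkE3 1 0 0)
      - 2 * (1 / t) * (1 / u + 1 / t) * Dfun τ Y (mkE3 1 0 0)
      ≤ (2 + 3 * τ ^ 2) * ((1 + C) ^ 2 * (u + t)) ^ 2 := by
  have hXi : ∀ i, |X i - mkE3 1 (-u) 0 i| ≤ C * u ^ 2 := fun i => by
    have := (coord_norm_le (X - mkE3 1 (-u) 0) i).trans hX
    simpa using this
  have hYi : ∀ i, |Y i - mkE3 1 t 0 i| ≤ C * t ^ 2 := fun i => by
    have := (coord_norm_le (Y - mkE3 1 t 0) i).trans hY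
    simpa using this
  have gP : ∀ s : ℝ, |s| ≤ 1 → ∀ i, |mkE3 1 s 0 i| ≤ 1 := by
    intro s hs i; fin_cases i <;> simp [hs]
  have hu' : |-u| ≤ 1 := by rw [abs_neg, abs_of_pos hu]; exact hu1
  have ht' : |t| ≤ 1 := by rw [abs_of_pos ht]; exact ht1
  -- second order expansions of products of coordinates
  have gQ : ∀ (s : ℝ) (i j : Fin 3), |mkE3 1 s 0 i * mkE3 1 s 0 j - mkE3 1 0 0 i * mkE3 1 0 0 j
      - s * (mkE3 1 0 0 i * mkE3 0 1 0 j + mkE3 0 1 0 i * mkE3 1 0 0 j)| ≤ s ^ 2 := by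
    intro s i j
    fin_cases i <;> fin_cases j <;> simp [sq_nonneg, ← sq, abs_of_nonneg]
  have big : ∀ i j, |X i * X j - mkE3 1 0 0 i * mkE3 1 0 0 j
      - (-u) * (mkE3 1 0 0 i * mkE3 0 1 0 j + mkE3 0 1 0 i * mkE3 1 0 0 j)| ≤ (1 + C) ^ 2 * u ^ 2 := by
    intro i j
    have h1 := prod_aux hC (gP _ hu' i) (gP _ hu' j) (sq_nonneg u) (by nlinarith) (hXi i) (hXi j)
    have h2 := gQ (-u) i j
    rw [neg_sq] at h2
    have := abs_add_le (X i * X j - mkE3 1 (-u) 0 i * mkE3 1 (-u) 0 j)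
      (mkE3 1 (-u) 0 i * mkE3 1 (-u) 0 j - mkE3 1 0 0 i * mkE3 1 0 0 j
      - (-u) * (mkE3 1 0 0 i * mkE3 0 1 0 j + mkE3 0 1 0 i * mkE3 1 0 0 j))
    refine le_trans (le_of_eq ?_) (this.trans ?_)
    · congr 1; ring
    · nlinarith
  have big' : ∀ i j, |Y i * Y j - mkE3 1 0 0 i * mkE3 1 0 0 j
      - t * (mkE3 1 0 0 i * mkE3 0 1 0 j + mkE3 0 1 0 i * mkE3 1 0 0 j)| ≤ (1 + C) ^ 2 * t ^ 2 := by
    intro i j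
    have h1 := prod_aux hC (gP _ ht' i) (gP _ ht' j) (sq_nonneg t) (by nlinarith) (hYi i) (hYi j)
    have h2 := gQ t i j
    have := abs_add_le (Y i * Y j - mkE3 1 t 0 i * mkE3 1 t 0 j)
      (mkE3 1 t 0 i * mkE3 1 t 0 j - mkE3 1 0 0 i * mkE3 1 0 0 j
      - t * (mkE3 1 0 0 i * mkE3 0 1 0 j + mkE3 0 1 0 i * mkE3 1 0 0 j))
    refine le_trans (le_of_eq ?_) (this.trans ?_)
    · congr 1; ring
    · nlinarith
  obtain ⟨φ2, hφ2⟩ : ∃ φ : Fin 3 → Fin 3 → ℝ, φ = fun i j =>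
    (X i * X j - mkE3 1 0 0 i * mkE3 1 0 0 j) / u + (Y i * Y j - mkE3 1 0 0 i * mkE3 1 0 0 j) / t :=
    ⟨_, rfl⟩
  obtain ⟨φ1, hφ1⟩ : ∃ φ : Fin 3 → ℝ, φ = fun i =>
    (X i - mkE3 1 0 0 i) / u + (Y i - mkE3 1 0 0 i) / t := ⟨_, rfl⟩
  obtain ⟨T, hT⟩ : ∃ T, T = (1 + C) ^ 2 * (u + t) := ⟨_, rfl⟩
  have b2 : ∀ i j, φ2 i j ^ 2 ≤ T ^ 2 := by
    intro i j
    have := frac_aux hu ht (big i j) (big' i j)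
    apply sq_le_sq'  <;> [skip; skip] <;> rw [hT]
    · have h := (abs_le.1 this).1
      refine h.trans (le_of_eq ?_)
      rw [hφ2]; field_simp; ring
    · have h := (abs_le.1 this).2
      refine le_trans (le_of_eq ?_) h
      rw [hφ2]; field_simp; ring
  have b1 : ∀ i, φ1 i ^ 2 ≤ T ^ 2 := by
    intro i
    have hCC : C ≤ (1 + C) ^ 2 := by nlinarith
    have := frac_aux hu ht ((hXi i).trans (mul_le_mul_of_nonneg_right hCC (sq_nonneg u)))
      ((hYi i).trans (mul_le_mul_of_nonneg_right hCC (sq_nonneg t)))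
    have e : φ1 i = (X i - mkE3 1 (-u) 0 i) / u + (Y i - mkE3 1 t 0 i) / t := by
      rw [hφ1]; fin_cases i <;> simp <;> field_simp <;> ring
    rw [← e, ← hT] at this
    exact sq_le_sq' (abs_le.1 this).1 (abs_le.1 this).2
  have e : (1 / u) ^ 2 * Dfun τ X X + (1 / t) ^ 2 * Dfun τ Y Y
      + (1 / u + 1 / t) ^ 2 * Dfun τ (mkE3 1 0 0) (mkE3 1 0 0) + 2 * (1 / u) * (1 / t) * Dfun τ X Y
      - 2 * (1 / u) * (1 / u + 1 / t) * Dfun τ X (mkE3 1 0 0)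
      - 2 * (1 / t) * (1 / u + 1 / t) * Dfun τ Y (mkE3 1 0 0)
      = (1 / 2) * (φ1 0 ^ 2 + φ1 1 ^ 2 + φ1 2 ^ 2) + (τ ^ 2 / 4) * (φ2 0 0 ^ 2 + φ2 1 1 ^ 2 + φ2 2 2 ^ 2
        + 2 * φ2 0 1 ^ 2 + 2 * φ2 0 2 ^ 2 + 2 * φ2 1 2 ^ 2) := by
    rw [hφ1, hφ2]
    simp only [D_eq, inner3, mkE3_0, mkE3_1, mkE3_2, div_eq_mul_inv]
    ring
  rw [e, ← hT]
  have := b2 0 0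
  have := b2 1 1
  have := b2 2 2
  have := b2 0 1
  have := b2 0 2
  have := b2 1 2
  have := b1 0
  have := b1 1
  have := b1 2
  have k : (τ ^ 2 / 4) * (φ2 0 0 ^ 2 + φ2 1 1 ^ 2 + φ2 2 2 ^ 2
        + 2 * φ2 0 1 ^ 2 + 2 * φ2 0 2 ^ 2 + 2 * φ2 1 2 ^ 2) ≤ (τ ^ 2 / 4) * (9 * T ^ 2) := by
    apply mul_le_mul_of_nonneg_left _ (by positivity)
    linarith
  nlinarith [mul_nonneg (sq_nonneg τ) (sq_nonneg T), sq_nonneg T]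

lemma L_self (τ : ℝ) {x : E3} (hx : x ∈ Sphere2) : Lfun τ x x = 1 ∧ Dfun τ x x = 1 := by
  have h : ⟪x, x⟫ = (1:ℝ) := by rw [real_inner_self_eq_norm_sq, sph_norm hx]; norm_num
  have : Dfun τ x x = 1 := by unfold Dfun; rw [h]; ring
  refine ⟨?_, this⟩
  unfold Lfun; rw [this]; norm_num

lemma F_bound {τ : ℝ} {ρ : Measure E3} (hmin : IsMinimizer τ ρ) {X Y p y : E3}
    (hX : X ∈ msupport ρ) (hY : Y ∈ msupport ρ) (hp : p ∈ msupport ρ) (hy : y ∈ msupport ρ)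
    (a b B : ℝ) (hB : 0 ≤ B)
    (hN : a ^ 2 * Lfun τ X X + b ^ 2 * Lfun τ Y Y + (a + b) ^ 2 * Lfun τ p p + 2 * a * b * Lfun τ X Y
      - 2 * a * (a + b) * Lfun τ X p - 2 * b * (a + b) * Lfun τ Y p ≤ B ^ 2) :
    |a * Lfun τ X y + b * Lfun τ Y y - (a + b) * Lfun τ p y| ≤ B := by
  set F := a * Lfun τ X y + b * Lfun τ Y y - (a + b) * Lfun τ p y with hF
  have h := psd_pts hmin (ι := Fin 4) ![X, p, Y, y] (by
    intro i; fin_cases i <;> simpa) ![a, -(a + b), b, -F]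
  simp only [Fin.sum_univ_four, Matrix.cons_val_zero, Matrix.cons_val_one, Matrix.cons_val] at h
  rw [L_symm τ p X, L_symm τ y X, L_symm τ p Y, L_symm τ y p, L_symm τ y Y, L_symm τ Y X,
    (L_self τ (msupport_sub hmin.2.2.1 hy)).1] at h
  have : F ^ 2 ≤ B ^ 2 := by
    have e : F * F = F * (a * Lfun τ X y + b * Lfun τ Y y - (a + b) * Lfun τ p y) := by rw [← hF]
    linarith
  exact abs_le_of_sq_le_sq this hB

lemma D_pc (τ s : ℝ) (y : E3) : Dfun τ (pcurve s) y = (1 / 4) * (1 + (Real.cos s * y 0 + Real.sin s * y 1))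
    * (2 - τ ^ 2 * (1 - (Real.cos s * y 0 + Real.sin s * y 1))) := by
  unfold Dfun; rw [inner3]; simp [pcurve]

lemma pcurve_zero : pcurve 0 = mkE3 1 0 0 := by simp [pcurve]

lemma D_pc_cont (τ : ℝ) (y : E3) : Continuous (fun s => Dfun τ (pcurve s) y) := by
  simp only [D_pc]; fun_prop

open Filter Topology in
lemma ptlim {τ : ℝ} (hτ : 6 < τ ^ 2) {y : E3} (hy : y ∈ Sphere2) {u t : ℕ → ℝ}
    (hu : ∀ n, 0 < u n) (ht : ∀ n, 0 < t n) (hu0 : Tendsto u atTop (𝓝 0)) (ht0 : Tendsto t atTop (𝓝 0))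
    (K : ℝ) (hK : ∀ᶠ n in atTop, |(Lfun τ (pcurve (-(u n))) y - Lfun τ (mkE3 1 0 0) y) / u n
      + (Lfun τ (pcurve (t n)) y - Lfun τ (mkE3 1 0 0) y) / t n| ≤ K * (u n + t n)) :
    Tendsto (fun n => ((Lfun τ (pcurve (-(u n))) y - Lfun τ (mkE3 1 0 0) y) / u n
      + (Lfun τ (pcurve (t n)) y - Lfun τ (mkE3 1 0 0) y) / t n) / (u n + t n)) atTop
      (𝓝 (if 1 - 2 / τ ^ 2 < y 0 then Lam τ y else 0)) := by
  have hτ0 : 0 < τ ^ 2 := by linarith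
  have hm : τ ^ 2 * (2 / τ ^ 2) = 2 := mul_div_cancel₀ _ hτ0.ne'
  have hz0 : 0 < 1 - 2 / τ ^ 2 := by
    rw [sub_pos, div_lt_one hτ0]; linarith
  have hut : Tendsto (fun n => u n + t n) atTop (𝓝 0) := by simpa using hu0.add ht0
  have hun : Tendsto (fun n => -(u n)) atTop (𝓝 0) := by simpa using hu0.neg
  have hu1 : ∀ᶠ n in atTop, |-(u n)| ≤ 1 := by
    filter_upwards [hu0.eventually (eventually_le_nhds (zero_lt_one))] with n hn
    rw [abs_neg, abs_of_pos (hu n)]; exact hn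
  have ht1 : ∀ᶠ n in atTop, |t n| ≤ 1 := by
    filter_upwards [ht0.eventually (eventually_le_nhds (zero_lt_one))] with n hn
    rw [abs_of_pos (ht n)]; exact hn
  have hD0 : Dfun τ (pcurve 0) y = (1 / 4) * (1 + y 0) * (2 - τ ^ 2 * (1 - y 0)) := by
    rw [D_pc]; simp
  have hDe : 2 - τ ^ 2 * (1 - y 0) = τ ^ 2 * (y 0 - (1 - 2 / τ ^ 2)) := by
    linear_combination -hm
  rw [hDe] at hD0
  have hDu : Tendsto (fun n => Dfun τ (pcurve (-(u n))) y) atTop (𝓝 (Dfun τ (pcurve 0) y)) :=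
    ((D_pc_cont τ y).tendsto 0).comp hun
  have hDt : Tendsto (fun n => Dfun τ (pcurve (t n)) y) atTop (𝓝 (Dfun τ (pcurve 0) y)) :=
    ((D_pc_cont τ y).tendsto 0).comp ht0
  obtain ⟨b0, b1⟩ := coord_le hy
  rcases lt_trichotomy (y 0) (1 - 2 / τ ^ 2) with hlt | heq | hgt
  · rw [if_neg (not_lt.2 hlt.le)]
    -- inner products eventually below the threshold
    have key : ∀ s : ℕ → ℝ, Tendsto s atTop (𝓝 0) → ∀ᶠ n in atTop, Lfun τ (pcurve (s n)) y = 0 := by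
      intro s hs
      have hc : Continuous (fun s => Real.cos s * y 0 + Real.sin s * y 1) := by fun_prop
      have h1 : Tendsto (fun n => Real.cos (s n) * y 0 + Real.sin (s n) * y 1) atTop (𝓝 (y 0)) := by
        have := (hc.tendsto 0).comp hs
        simpa [Function.comp_def] using this
      filter_upwards [h1.eventually (eventually_lt_nhds hlt)] with n hn
      unfold Lfun
      apply max_eq_left
      have hi := (abs_le.1 (inner_abs_le (pcurve_mem (s n)) hy)).1
      have hi2 : ⟪pcurve (s n), y⟫ = Real.cos (s n) * y 0 + Real.sin (s n) * y 1 := by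
        rw [inner3]; simp [pcurve]
      rw [hi2] at hi
      rw [D_pc]
      have e : 2 - τ ^ 2 * (1 - (Real.cos (s n) * y 0 + Real.sin (s n) * y 1))
        = τ ^ 2 * ((Real.cos (s n) * y 0 + Real.sin (s n) * y 1) - (1 - 2 / τ ^ 2)) := by
        linear_combination -hm
      rw [e]
      apply mul_nonpos_of_nonneg_of_nonpos
      · linarith
      · apply mul_nonpos_of_nonneg_of_nonpos hτ0.le; linarith
    have hp : Lfun τ (mkE3 1 0 0) y = 0 := by
      have := key (fun _ => 0) tendsto_const_nhds
      rw [eventually_const] at this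
      rwa [pcurve_zero] at this
    apply tendsto_const_nhds.congr'
    filter_upwards [key _ hun, key _ ht0] with n h1 h2
    rw [h1, h2, hp]; simp
  · rw [if_neg (not_lt.2 heq.le)]
    have hDp : Dfun τ (mkE3 1 0 0) y = 0 := by
      rw [← pcurve_zero, hD0, heq]; simp
    have hp : Lfun τ (mkE3 1 0 0) y = 0 := by
      unfold Lfun; rw [hDp]; simp
    by_cases hy1 : y 1 = 0
    · have key : ∀ s : ℝ, Lfun τ (pcurve s) y = 0 := by
        intro s
        unfold Lfun
        apply max_eq_left
        rw [D_pc, hy1, mul_zero, add_zero]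
        have e : 2 - τ ^ 2 * (1 - (Real.cos s * y 0)) = τ ^ 2 * (Real.cos s * y 0 - (1 - 2 / τ ^ 2)) := by
          linear_combination -hm
        rw [e, heq]
        have hh : (1 - 2 / τ ^ 2) ≤ 1 := by
          have : 0 < 2 / τ ^ 2 := by positivity
          linarith
        apply mul_nonpos_of_nonneg_of_nonpos
        · nlinarith [Real.neg_one_le_cos s]
        · apply mul_nonpos_of_nonneg_of_nonpos hτ0.le
          nlinarith [Real.cos_le_one s]
      simp [key, hp]
    · exfalso
      have hd : del τ y ≠ 0 := by
        unfold del
        have : 0 < y 0 := by rw [heq]; exact hz0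
        have : 0 < 1 / 2 * (1 + τ ^ 2 * y 0) := by positivity
        exact mul_ne_zero this.ne' hy1
      -- lower bound
      have low : ∀ᶠ n in atTop, |del τ y| ≤
          (K + 2 * (|Lam τ y| + (1 + 5 * τ ^ 2))) * (u n + t n) := by
        filter_upwards [hK, hu1, ht1] with n h1 h2 h3
        rw [hp, sub_zero, sub_zero] at h1
        have A := h_exp τ hy h2
        have B := h_exp τ hy h3
        rw [hDp] at A B
        rw [abs_neg, abs_of_pos (hu n)] at A h2
        rw [abs_of_pos (ht n)] at B h3
        have hLu : 0 ≤ Lfun τ (pcurve (-(u n))) y / u n := div_nonneg (L_nonneg _ _ _) (hu n).le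
        have hLt : 0 ≤ Lfun τ (pcurve (t n)) y / t n := div_nonneg (L_nonneg _ _ _) (ht n).le
        have h1' := (abs_le.1 h1).2
        have cu : -del τ y - (|Lam τ y| + (1 + 5 * τ ^ 2)) * u n ≤ Lfun τ (pcurve (-(u n))) y / u n := by
          rw [le_div_iff₀ (hu n)]
          refine le_trans ?_ (le_max_right _ _)
          have := (abs_le.1 A).1
          have l := neg_abs_le (Lam τ y)
          have : -|Lam τ y| * u n ^ 2 ≤ Lam τ y * u n ^ 2 := mul_le_mul_of_nonneg_right l (sq_nonneg _)
          have : (1 + 5 * τ ^ 2) * (u n ^ 3) ≤ (1 + 5 * τ ^ 2) * u n ^ 2 := by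
            apply mul_le_mul_of_nonneg_left _ (by positivity)
            exact pow_le_pow_of_le_one (hu n).le h2 (by norm_num)
          linarith
        have ct : del τ y - (|Lam τ y| + (1 + 5 * τ ^ 2)) * t n ≤ Lfun τ (pcurve (t n)) y / t n := by
          rw [le_div_iff₀ (ht n)]
          refine le_trans ?_ (le_max_right _ _)
          have := (abs_le.1 B).1
          have l := neg_abs_le (Lam τ y)
          have : -|Lam τ y| * t n ^ 2 ≤ Lam τ y * t n ^ 2 := mul_le_mul_of_nonneg_right l (sq_nonneg _)
          have : (1 + 5 * τ ^ 2) * (t n ^ 3) ≤ (1 + 5 * τ ^ 2) * t n ^ 2 := by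
            apply mul_le_mul_of_nonneg_left _ (by positivity)
            exact pow_le_pow_of_le_one (ht n).le h3 (by norm_num)
          linarith
        have hc : 0 ≤ |Lam τ y| + (1 + 5 * τ ^ 2) := by positivity
        have m1 := mul_nonneg hc (hu n).le
        have m2 := mul_nonneg hc (ht n).le
        rw [abs_le]; constructor <;> linarith
      have hl : Tendsto (fun n => (K + 2 * (|Lam τ y| + (1 + 5 * τ ^ 2))) * (u n + t n)) atTop (𝓝 0) := by
        simpa using hut.const_mul (K + 2 * (|Lam τ y| + (1 + 5 * τ ^ 2)))
      have := ge_of_tendsto hl low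
      exact hd (abs_eq_zero.1 (le_antisymm this (abs_nonneg _)))
  · rw [if_pos hgt]
    have hpos : 0 < Dfun τ (pcurve 0) y := by
      rw [hD0]
      have : 0 < y 0 - (1 - 2 / τ ^ 2) := by linarith
      have : 0 < 1 + y 0 := by linarith
      positivity
    have hp : Lfun τ (mkE3 1 0 0) y = Dfun τ (mkE3 1 0 0) y := by
      rw [pcurve_zero] at hpos
      exact max_eq_right hpos.le
    rw [tendsto_iff_norm_sub_tendsto_zero]
    have hl : Tendsto (fun n => (1 + 5 * τ ^ 2) * (u n + t n)) atTop (𝓝 0) := by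
      simpa using hut.const_mul (1 + 5 * τ ^ 2)
    refine squeeze_zero' (Eventually.of_forall fun n => norm_nonneg _) ?_ hl
    filter_upwards [hu1, ht1, hDu.eventually (eventually_gt_nhds hpos),
      hDt.eventually (eventually_gt_nhds hpos)] with n h2 h3 h4 h5
    have A := h_exp τ hy h2
    have B := h_exp τ hy h3
    have e1 : Lfun τ (pcurve (-(u n))) y = Dfun τ (pcurve (-(u n))) y := max_eq_right h4.le
    have e2 : Lfun τ (pcurve (t n)) y = Dfun τ (pcurve (t n)) y := max_eq_right h5.le
    rw [e1, e2, hp, Real.norm_eq_abs]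
    rw [abs_neg, abs_of_pos (hu n)] at A
    rw [abs_of_pos (ht n)] at B
    set P := Dfun τ (pcurve (-(u n))) y - Dfun τ (mkE3 1 0 0) y with hP
    set Q := Dfun τ (pcurve (t n)) y - Dfun τ (mkE3 1 0 0) y with hQ
    have hs : 0 < u n + t n := add_pos (hu n) (ht n)
    have hun := hu n
    have htn := ht n
    have e : (P / u n + Q / t n) / (u n + t n) - Lam τ y
        = ((P - del τ y * (-(u n)) - Lam τ y * (-(u n)) ^ 2) / u n
          + (Q - del τ y * t n - Lam τ y * (t n) ^ 2) / t n) / (u n + t n) := by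
      field_simp; ring
    rw [e, abs_div, abs_of_pos hs, div_le_iff₀ hs]
    refine (abs_add_le _ _).trans ?_
    rw [abs_div, abs_div, abs_of_pos hun, abs_of_pos htn]
    have c1 : |P - del τ y * (-(u n)) - Lam τ y * (-(u n)) ^ 2| / u n ≤ (1 + 5 * τ ^ 2) * u n ^ 2 := by
      rw [div_le_iff₀ hun]; linarith
    have c2 : |Q - del τ y * t n - Lam τ y * (t n) ^ 2| / t n ≤ (1 + 5 * τ ^ 2) * t n ^ 2 := by
      rw [div_le_iff₀ htn]; linarith
    have c3 : (1 + 5 * τ ^ 2) * (u n ^ 2 + t n ^ 2) ≤ (1 + 5 * τ ^ 2) * ((u n + t n) * (u n + t n)) := by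
      apply mul_le_mul_of_nonneg_left _ (by positivity)
      nlinarith [mul_pos hun htn]
    linarith

lemma Lam_neg {τ : ℝ} (hτ : 6 < τ ^ 2) {y : E3} (hy : y ∈ Sphere2) (h : 1 - 2 / τ ^ 2 < y 0) :
    Lam τ y < 0 := by
  rw [sph_iff] at hy
  have hτ0 : 0 < τ ^ 2 := by linarith
  have h23 : 2 / 3 < y 0 := by
    have : 2 / τ ^ 2 < 1 / 3 := by rw [div_lt_iff₀ hτ0]; linarith
    linarith
  have h1 : y 1 ^ 2 ≤ 1 - y 0 ^ 2 := by nlinarith [sq_nonneg (y 2)]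
  have h2 : τ ^ 2 * y 1 ^ 2 ≤ τ ^ 2 * (1 - y 0 ^ 2) := mul_le_mul_of_nonneg_left h1 hτ0.le
  have h3 : τ ^ 2 - 2 < τ ^ 2 * y 0 := by
    have := mul_lt_mul_of_pos_left h hτ0
    rw [mul_sub, mul_div_cancel₀ _ hτ0.ne'] at this
    linarith
  have h4 : τ ^ 2 * (1 - y 0 ^ 2) - y 0 - τ ^ 2 * y 0 ^ 2 < 0 := by
    nlinarith
  unfold Lam
  nlinarith

open Filter Topology in
lemma core {τ : ℝ} (hτ : 6 < τ ^ 2) {ρ : Measure E3} (hmin : IsMinimizer τ ρ)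
    (hp : mkE3 1 0 0 ∈ msupport ρ) {u t : ℕ → ℝ}
    (hu : ∀ n, 0 < u n) (ht : ∀ n, 0 < t n) (hu0 : Tendsto u atTop (𝓝 0)) (ht0 : Tendsto t atTop (𝓝 0))
    (K : ℝ) (hK : ∀ᶠ n in atTop, ∀ y ∈ msupport ρ,
      |(Lfun τ (pcurve (-(u n))) y - Lfun τ (mkE3 1 0 0) y) / u n
      + (Lfun τ (pcurve (t n)) y - Lfun τ (mkE3 1 0 0) y) / t n| ≤ K * (u n + t n)) : False := by
  have hmin' := hmin
  obtain ⟨hP, hR, hS, hM⟩ := hmin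
  set Φ : E3 → ℝ := fun y => if 1 - 2 / τ ^ 2 < y 0 then Lam τ y else 0 with hΦ
  set F : ℕ → E3 → ℝ := fun n y => ((Lfun τ (pcurve (-(u n))) y - Lfun τ (mkE3 1 0 0) y) / u n
      + (Lfun τ (pcurve (t n)) y - Lfun τ (mkE3 1 0 0) y) / t n) / (u n + t n) with hF
  have hlim : Tendsto (fun n => ∫ y, F n y ∂ρ) atTop (𝓝 (∫ y, Φ y ∂ρ)) := by
    apply tendsto_integral_filter_of_dominated_convergence (fun _ => K)
    · apply Eventually.of_forall
      intro n
      have h1 := L_cont_right τ (pcurve (-(u n)))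
      have h2 := L_cont_right τ (pcurve (t n))
      have h3 := L_cont_right τ (mkE3 1 0 0)
      apply Continuous.aestronglyMeasurable
      simp only [hF]
      exact ((((h1.sub h3).div_const _).add ((h2.sub h3).div_const _)).div_const _)
    · filter_upwards [hK] with n hn
      filter_upwards [ae_msupport ρ] with y hy
      have hs : 0 < u n + t n := add_pos (hu n) (ht n)
      rw [Real.norm_eq_abs, hF]
      simp only
      rw [abs_div, abs_of_pos hs, div_le_iff₀ hs]
      exact hn y hy
    · exact integrable_const _
    · filter_upwards [ae_msupport ρ] with y hy
      exact ptlim hτ (msupport_sub hS hy) hu ht hu0 ht0 K (hK.mono fun n hn => hn y hy)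
  have hnn : ∀ n, 0 ≤ ∫ y, F n y ∂ρ := by
    intro n
    have i1 := integrable_L' (τ := τ) hS (pcurve (-(u n)))
    have i2 := integrable_L' (τ := τ) hS (pcurve (t n))
    have i3 := integrable_L' (τ := τ) hS (mkE3 1 0 0)
    have e : ∫ y, F n y ∂ρ = ((∫ y, Lfun τ (pcurve (-(u n))) y ∂ρ - ∫ y, Lfun τ (mkE3 1 0 0) y ∂ρ) / u n
      + (∫ y, Lfun τ (pcurve (t n)) y ∂ρ - ∫ y, Lfun τ (mkE3 1 0 0) y ∂ρ) / t n) / (u n + t n) := by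
      simp only [hF]
      have j1 : Integrable (fun y => (Lfun τ (pcurve (-(u n))) y - Lfun τ (mkE3 1 0 0) y) / u n) ρ :=
        (i1.sub i3).div_const _
      have j2 : Integrable (fun y => (Lfun τ (pcurve (t n)) y - Lfun τ (mkE3 1 0 0) y) / t n) ρ :=
        (i2.sub i3).div_const _
      rw [integral_div, integral_add j1 j2,
        integral_div, integral_div, integral_sub i1 i3, integral_sub i2 i3]
    rw [e]
    have a1 := EL1 hmin' (pcurve_mem (-(u n)))
    have a2 := EL1 hmin' (pcurve_mem (t n))
    have a3 := EL2 hmin' hp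
    exact div_nonneg (add_nonneg (div_nonneg (by linarith) (hu n).le)
      (div_nonneg (by linarith) (ht n).le)) (add_pos (hu n) (ht n)).le
  have hI : 0 ≤ ∫ y, Φ y ∂ρ := ge_of_tendsto' hlim hnn
  have c0 : Continuous (fun y : E3 => y 0) := by fun_prop
  have c1 : Continuous (fun y : E3 => y 1) := by fun_prop
  have hOpen : IsOpen {y : E3 | 1 - 2 / τ ^ 2 < y 0} := isOpen_lt continuous_const c0
  have hΦm : Measurable Φ := by
    refine Measurable.ite hOpen.measurableSet ?_ measurable_const
    apply Continuous.measurable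
    unfold Lam
    fun_prop
  have hneg : ∀ᵐ y ∂ρ, Φ y ≤ 0 := by
    filter_upwards [ae_sphere hS] with y hy
    simp only [hΦ]
    split_ifs with h
    · exact (Lam_neg hτ hy h).le
    · exact le_rfl
  have hint : Integrable Φ ρ := by
    refine Integrable.of_bound (C := 1 + τ ^ 2) hΦm.aestronglyMeasurable ?_
    filter_upwards [ae_sphere hS] with y hy
    simp only [hΦ]
    split_ifs with h
    · obtain ⟨b0, b1⟩ := coord_le hy
      have := (Lam_neg hτ hy h)
      rw [Real.norm_eq_abs, abs_of_neg this]
      unfold Lam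
      have : y 0 ^ 2 ≤ 1 := by rw [← sq_abs]; nlinarith [abs_nonneg (y 0)]
      have := (abs_le.1 b0).2
      nlinarith [sq_nonneg (τ * y 1), mul_le_mul_of_nonneg_left ‹y 0 ^ 2 ≤ 1› (sq_nonneg τ), sq_nonneg τ]
    · simp; positivity
  have h0 : ∫ y, (-Φ y) ∂ρ = 0 := by
    rw [integral_neg]
    have := integral_nonpos_of_ae hneg
    linarith
  have hint' : Integrable (fun y => -Φ y) ρ := hint.neg
  rw [integral_eq_zero_iff_of_nonneg_ae (by filter_upwards [hneg] with y hy; simpa using hy) hint'] at h0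
  have hz : ρ {y : E3 | 1 - 2 / τ ^ 2 < y 0} = 0 := by
    have : ∀ᵐ y ∂ρ, ¬ (1 - 2 / τ ^ 2 < y 0) := by
      filter_upwards [h0, ae_sphere hS] with y h1 h2 h3
      have := Lam_neg hτ h2 h3
      simp only [hΦ, if_pos h3, Pi.zero_apply] at h1
      linarith
    rw [ae_iff] at this
    simpa using this
  have hpos := hp {y : E3 | 1 - 2 / τ ^ 2 < y 0} hOpen (by
    have : 0 < 2 / τ ^ 2 := by positivity
    simpa using (by linarith : 1 - 2 / τ ^ 2 < 1))
  exact hpos.ne' hz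

open Filter Topology in
lemma taylor2 {δ : ℝ} (hδ : 0 < δ) {γ : ℝ → E3} (hsm : ContDiffOn ℝ 2 γ (Set.Ioo (-δ) δ))
    (h0 : γ 0 = mkE3 1 0 0) (h1 : deriv γ 0 = mkE3 0 1 0) :
    ∃ C r : ℝ, 0 ≤ C ∧ 0 < r ∧ ∀ t, |t| < r → ‖γ t - mkE3 1 t 0‖ ≤ C * t ^ 2 := by
  have h0m : (0:ℝ) ∈ Set.Ioo (-δ) δ := ⟨by linarith, hδ⟩
  have hs : ContDiffOn ℝ (1 + 1) γ (Set.Ioo (-δ) δ) := by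
    have e : (1 + 1 : WithTop ℕ∞) = 2 := by norm_num
    rw [e]; exact hsm
  rw [contDiffOn_succ_iff_deriv_of_isOpen isOpen_Ioo] at hs
  obtain ⟨hd, -, hd'⟩ := hs
  have hdd : DifferentiableAt ℝ (deriv γ) 0 :=
    (hd'.differentiableOn (by norm_num)).differentiableAt (isOpen_Ioo.mem_nhds h0m)
  have hO := hdd.isBigO_sub
  obtain ⟨C, hC⟩ := hO.bound
  rw [Metric.eventually_nhds_iff] at hC
  obtain ⟨r, hr, hC⟩ := hC
  refine ⟨max C 0, min r δ, le_max_right _ _, lt_min hr hδ, ?_⟩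
  intro t ht
  have htr : |t| < r := ht.trans_le (min_le_left _ _)
  have htδ : |t| < δ := ht.trans_le (min_le_right _ _)
  have hder : ∀ x ∈ Metric.closedBall (0:ℝ) |t|,
      HasDerivAt (fun s => γ s - s • mkE3 0 1 0) (deriv γ x - mkE3 0 1 0) x := by
    intro x hx
    have hx' : |x| ≤ |t| := by simpa using hx
    have hxm : x ∈ Set.Ioo (-δ) δ := abs_lt.1 (hx'.trans_lt htδ)
    have := (hd.differentiableAt (isOpen_Ioo.mem_nhds hxm)).hasDerivAt.sub
      ((hasDerivAt_id x).smul_const (mkE3 0 1 0))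
    rw [one_smul] at this
    exact this
  have hb := (convex_closedBall (0:ℝ) |t|).norm_image_sub_le_of_norm_hasDerivWithin_le
    (f := fun s => γ s - s • mkE3 0 1 0) (f' := fun x => deriv γ x - mkE3 0 1 0)
    (C := max C 0 * |t|) (x := 0) (y := t)
    (fun x hx => (hder x hx).hasDerivWithinAt) (by
      intro x hx
      have hx' : |x| ≤ |t| := by simpa using hx
      have := hC (y := x) (by simpa using hx'.trans_lt htr)
      rw [h1, sub_zero, Real.norm_eq_abs] at this
      refine this.trans ?_
      exact mul_le_mul (le_max_left _ _) hx' (abs_nonneg _) (le_max_right _ _))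
    (by simp) (by simp)
  have e : (γ t - t • mkE3 0 1 0) - (γ 0 - (0:ℝ) • mkE3 0 1 0) = γ t - mkE3 1 t 0 := by
    rw [h0]
    ext i; fin_cases i <;> simp
  rw [e] at hb
  refine hb.trans (le_of_eq ?_)
  rw [sub_zero, Real.norm_eq_abs, mul_assoc, ← sq, sq_abs]

open Filter Topology in
lemma contra {τ β δ : ℝ} (hτ : Real.sqrt 6 < τ)
    {ρ : Measure E3} (hmin : IsMinimizer τ ρ) (hδ : 0 < δ)
    {γ : ℝ → E3} (hsm : ∀ n : ℕ, ContDiffOn ℝ n γ (Set.Ioo (-δ) δ))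
    (h0 : γ 0 = mkE3 1 0 0) (h1 : deriv γ 0 = mkE3 0 1 0)
    (hacc : UniformTwoSidedAcc (msupport ρ) β δ γ) : False := by
  have hτ6 : 6 < τ ^ 2 := by
    have := Real.lt_sq_of_sqrt_lt hτ
    exact this
  obtain ⟨C, r, hC, hr, hT⟩ := taylor2 hδ (by simpa using hsm 2) h0 h1
  obtain ⟨ε₀, hε0, hεδ, hA⟩ := hacc
  have hex : ∀ n : ℕ, ∃ u t : ℝ, 0 < u ∧ u ≤ ε₀ / ((n:ℝ) + 1) ∧ 0 < t ∧ t ≤ ε₀ / ((n:ℝ) + 1) ∧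
      γ (-u) ∈ msupport ρ ∧ γ t ∈ msupport ρ := by
    intro n
    have hpos : 0 < ε₀ / ((n:ℝ) + 1) := by positivity
    obtain ⟨⟨s, hs, hsM⟩, ⟨t, ht, htM⟩⟩ := hA (ε₀ / ((n:ℝ) + 1)) hpos (by
      apply div_le_self hε0.le
      have : (0:ℝ) ≤ n := Nat.cast_nonneg n
      linarith)
    have hp := Real.rpow_pos_of_pos hpos (1 + β)
    refine ⟨-s, t, by linarith [hs.2], by linarith [hs.1], by linarith [ht.1], ht.2.le, ?_, htM⟩
    rwa [neg_neg]
  choose u t hu hu' ht ht' hXM hYM using hex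
  have hlim : Tendsto (fun n : ℕ => ε₀ / ((n:ℝ) + 1)) atTop (𝓝 0) := by
    have := (tendsto_one_div_add_atTop_nhds_zero_nat (𝕜 := ℝ)).const_mul ε₀
    simpa [div_eq_mul_inv] using this
  have hu0 : Tendsto u atTop (𝓝 0) := squeeze_zero (fun n => (hu n).le) hu' hlim
  have ht0 : Tendsto t atTop (𝓝 0) := squeeze_zero (fun n => (ht n).le) ht' hlim
  have hun : Tendsto (fun n => -(u n)) atTop (𝓝 0) := by simpa using hu0.neg
  have hγc : ContinuousAt γ 0 :=
    (hsm 0).continuousOn.continuousAt (Ioo_mem_nhds (by linarith) hδ)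
  have hXl : Tendsto (fun n => γ (-(u n))) atTop (𝓝 (mkE3 1 0 0)) := by
    rw [← h0]; exact hγc.tendsto.comp hun
  have hYl : Tendsto (fun n => γ (t n)) atTop (𝓝 (mkE3 1 0 0)) := by
    rw [← h0]; exact hγc.tendsto.comp ht0
  have hp : mkE3 1 0 0 ∈ msupport ρ :=
    (isClosed_msupport ρ).mem_of_tendsto hYl (Eventually.of_forall hYM)
  have hsub := msupport_sub hmin.2.2.1
  have hDc : Continuous (fun z : E3 × E3 => Dfun τ z.1 z.2) := by
    unfold Dfun; fun_prop
  have hpp : 0 < Dfun τ (mkE3 1 0 0) (mkE3 1 0 0) := by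
    rw [(L_self τ (hsub hp)).2]; norm_num
  have hev : ∀ f g : ℕ → E3, Tendsto f atTop (𝓝 (mkE3 1 0 0)) → Tendsto g atTop (𝓝 (mkE3 1 0 0)) →
      ∀ᶠ n in atTop, Lfun τ (f n) (g n) = Dfun τ (f n) (g n) := by
    intro f g hf hg
    have := (hDc.tendsto (mkE3 1 0 0, mkE3 1 0 0)).comp (hf.prodMk_nhds hg)
    filter_upwards [this.eventually (eventually_gt_nhds hpp)] with n hn
    exact max_eq_right (le_of_lt hn)
  refine core hτ6 hmin hp hu ht hu0 ht0
    ((2 + 3 * τ ^ 2) * (1 + C) ^ 2 + (1 + τ ^ 2) * (C + 3)) ?_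
  filter_upwards [hev _ _ hXl hYl, hev _ _ hXl tendsto_const_nhds, hev _ _ hYl tendsto_const_nhds,
    hu0.eventually (eventually_lt_nhds (lt_min hr one_pos)),
    ht0.eventually (eventually_lt_nhds (lt_min hr one_pos))] with n e1 e2 e3 s1 s2 y hy
  have hun := hu n
  have htn := ht n
  obtain ⟨s1r, s11⟩ := lt_min_iff.1 s1
  obtain ⟨s2r, s21⟩ := lt_min_iff.1 s2
  have cX : ‖γ (-(u n)) - mkE3 1 (-(u n)) 0‖ ≤ C * u n ^ 2 := by
    have := hT (-(u n)) (by rwa [abs_neg, abs_of_pos hun])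
    rwa [neg_sq] at this
  have cY := hT (t n) (by rwa [abs_of_pos htn])
  have hN := N_bound τ C (u n) (t n) hC hun s11.le htn s21.le _ _ cX cY
  have hFb := F_bound hmin (hXM n) (hYM n) hp hy (1 / u n) (1 / t n)
    ((2 + 3 * τ ^ 2) * (1 + C) ^ 2 * (u n + t n)) (by positivity) (by
      rw [e1, e2, e3, (L_self τ (hsub (hXM n))).1, (L_self τ (hsub (hYM n))).1, (L_self τ (hsub hp)).1]
      rw [(L_self τ (hsub (hXM n))).2, (L_self τ (hsub (hYM n))).2, (L_self τ (hsub hp)).2] at hN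
      refine hN.trans ?_
      rw [mul_assoc, mul_pow (2 + 3 * τ ^ 2)]
      apply mul_le_mul_of_nonneg_right _ (sq_nonneg _)
      nlinarith [sq_nonneg τ])
  have d1 : |Lfun τ (pcurve (-(u n))) y - Lfun τ (γ (-(u n))) y| ≤ ((1 + τ ^ 2) * (C + 3)) * u n ^ 2 := by
    refine (L_lip τ (pcurve_mem _) (hsub (hXM n)) (hsub hy)).trans ?_
    rw [mul_assoc]
    apply mul_le_mul_of_nonneg_left _ (by positivity)
    have h3 := pcurve_close (s := -(u n)) (by rw [abs_neg, abs_of_pos hun]; exact s11.le)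
    rw [neg_sq] at h3
    have := norm_sub_le_norm_sub_add_norm_sub (pcurve (-(u n))) (mkE3 1 (-(u n)) 0) (γ (-(u n)))
    rw [norm_sub_rev (mkE3 1 (-(u n)) 0)] at this
    linarith
  have d2 : |Lfun τ (pcurve (t n)) y - Lfun τ (γ (t n)) y| ≤ ((1 + τ ^ 2) * (C + 3)) * t n ^ 2 := by
    refine (L_lip τ (pcurve_mem _) (hsub (hYM n)) (hsub hy)).trans ?_
    rw [mul_assoc]
    apply mul_le_mul_of_nonneg_left _ (by positivity)
    have h3 := pcurve_close (s := t n) (by rw [abs_of_pos htn]; exact s21.le)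
    have := norm_sub_le_norm_sub_add_norm_sub (pcurve (t n)) (mkE3 1 (t n) 0) (γ (t n))
    rw [norm_sub_rev (mkE3 1 (t n) 0)] at this
    linarith
  have hfr := frac_aux hun htn d1 d2
  have e : (Lfun τ (pcurve (-(u n))) y - Lfun τ (mkE3 1 0 0) y) / u n
      + (Lfun τ (pcurve (t n)) y - Lfun τ (mkE3 1 0 0) y) / t n
      = (1 / u n * Lfun τ (γ (-(u n))) y + 1 / t n * Lfun τ (γ (t n)) y
          - (1 / u n + 1 / t n) * Lfun τ (mkE3 1 0 0) y)
        + ((Lfun τ (pcurve (-(u n))) y - Lfun τ (γ (-(u n))) y) / u n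
          + (Lfun τ (pcurve (t n)) y - Lfun τ (γ (t n)) y) / t n) := by
    ring
  rw [e]
  refine (abs_add_le _ _).trans ?_
  refine (add_le_add hFb hfr).trans (le_of_eq ?_)
  ring

/-- Proposition 7.9: under the assumptions of Proposition 7.1, there
is no smooth arc-length curve through `q₁` osculating `K(p)` on which `q₁` is an
accumulation point of support points. -/
theorem stmt_19 (τ β δ : ℝ) (hτ : Real.sqrt 6 < τ) (hβ0 : 0 < β) (hβ : β < 1 / 6)
    (ρ : Measure E3) (hmin : IsMinimizer τ ρ) (hδ : 0 < δ)
    (γ : ℝ → E3) (hsm : ∀ n : ℕ, ContDiffOn ℝ n γ (Set.Ioo (-δ) δ))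
    (hmap : ∀ t ∈ Set.Ioo (-δ) δ, γ t ∈ Sphere2)
    (harc : ∀ t ∈ Set.Ioo (-δ) δ, ‖deriv γ t‖ = 1)
    (h0 : γ 0 = mkE3 1 0 0) (h1 : deriv γ 0 = mkE3 0 1 0)
    (hacc : UniformTwoSidedAcc (msupport ρ) β δ γ) :
    ¬ ∃ (δ' : ℝ) (c : ℝ → E3), 0 < δ' ∧
      (∀ n : ℕ, ContDiffOn ℝ n c (Set.Ioo (-δ') δ')) ∧
      (∀ t ∈ Set.Ioo (-δ') δ', c t ∈ Sphere2) ∧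
      (∀ t ∈ Set.Ioo (-δ') δ', ‖deriv c t‖ = 1) ∧
      c 0 = q1pt τ ∧
      deriv (fun t => ⟪mkE3 1 0 0, c t⟫) 0 = 0 ∧
      deriv (deriv fun t => ⟪mkE3 1 0 0, c t⟫) 0 = 0 ∧
      AccumulationPt (q1pt τ) (msupport ρ ∩ c '' Set.Ioo (-δ') δ') := by
  intro _
  exact contra hτ hmin hδ hsm h0 h1 hacc
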